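/- Action on principal symbols of integer contact order: let k ≥ 1 be an integer, λ, μ ∈ ℂ, f ∈ A homogeneous, and F₁, F₂ ∈ A homogeneous of the same parity. Then 𝓛_{X_f}(F₁∂_x^k + F₂∂_x^{k−1}D̄₁D̄₂) − (L^{μ−λ−k}_{X_f}(F₁))∂_x^k − (L^{μ−λ−k}_{X_f}(F₂))∂_x^{k−1}D̄₁D̄₂ belongs to D^{k−1/2}_{λμ}; i.e. both components of the principal symbol transform as (μ−λ−k)-densities. -/

import Mathlib

/-!
Functions on the supercircle `S^{1|2}`: the superalgebra
`A = C^∞(ℝ,ℂ)[ξ₁,ξ₂]`.  An element `f = f₀ + ξ₁f₁ + ξ₂f₂ + ξ₁ξ₂f₁₂`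
is encoded by the 4-tuple `(f₀, f₁, f₂, f₁₂)` of functions `ℝ → ℂ`.
-/

noncomputable section

abbrev SA : Type := (ℝ → ℂ) × (ℝ → ℂ) × (ℝ → ℂ) × (ℝ → ℂ)

namespace SA

def a0 (f : SA) : ℝ → ℂ := f.1
def a1 (f : SA) : ℝ → ℂ := f.2.1
def a2 (f : SA) : ℝ → ℂ := f.2.2.1
def a12 (f : SA) : ℝ → ℂ := f.2.2.2

/-- all four component functions are smooth -/
def Smooth (f : SA) : Prop :=
  ContDiff ℝ (⊤ : ℕ∞) (a0 f) ∧ ContDiff ℝ (⊤ : ℕ∞) (a1 f) ∧ ContDiff ℝ (⊤ : ℕ∞) (a2 f) ∧ ContDiff ℝ (⊤ : ℕ∞) (a12 f)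

/-- the (super-commutative) product of the Grassmann algebra `A`;
`ξᵢ² = 0`, `ξ₁ξ₂ = -ξ₂ξ₁`. -/
def gmul (f g : SA) : SA :=
  (a0 f * a0 g,
   a0 f * a1 g + a1 f * a0 g,
   a0 f * a2 g + a2 f * a0 g,
   a0 f * a12 g + a12 f * a0 g + a1 f * a2 g - a2 f * a1 g)

scoped infixl:70 " ⊙ " => SA.gmul

/-- the unit `1 ∈ A` -/
def one : SA := (1, 0, 0, 0)
/-- the even coordinate `x ∈ A` -/
def xx : SA := (fun t => (t : ℂ), 0, 0, 0)
/-- the odd coordinate `ξ₁ ∈ A` -/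
def xi1 : SA := (0, 1, 0, 0)
/-- the odd coordinate `ξ₂ ∈ A` -/
def xi2 : SA := (0, 0, 1, 0)

/-- `∂_x`, differentiating the coefficients -/
def dx (f : SA) : SA := (deriv (a0 f), deriv (a1 f), deriv (a2 f), deriv (a12 f))
/-- the left Grassmann derivative `∂_{ξ₁}` -/
def dxi1 (f : SA) : SA := (a1 f, 0, a12 f, 0)
/-- the left Grassmann derivative `∂_{ξ₂}` -/
def dxi2 (f : SA) : SA := (a2 f, -a12 f, 0, 0)
/-- `D̄₁ = ∂_{ξ₁} - ξ₁∂_x` -/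
def D1 (f : SA) : SA := dxi1 f - xi1 ⊙ dx f
/-- `D̄₂ = ∂_{ξ₂} - ξ₂∂_x` -/
def D2 (f : SA) : SA := dxi2 f - xi2 ⊙ dx f

def IsEven (f : SA) : Prop := a1 f = 0 ∧ a2 f = 0
def IsOdd (f : SA) : Prop := a0 f = 0 ∧ a12 f = 0
/-- `f` is homogeneous of parity `b` (`false` = even, `true` = odd) -/
def Homog (b : Bool) (f : SA) : Prop := if b then IsOdd f else IsEven f
/-- `(-1)^b` -/
def sgn (b : Bool) : ℂ := if b then -1 else 1
/-- `(-1)^(b*c)` -/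
def sgn2 (b c : Bool) : ℂ := if b && c then -1 else 1

/-- the contact vector field `X_f` (with `f` homogeneous of parity `b`)
applied to `g`:  `X_f(g) = f ∂_x g - (-1)^{p(f)} ½ (D̄₁(f)D̄₁(g) + D̄₂(f)D̄₂(g))` -/
def XV (b : Bool) (f : SA) (g : SA) : SA :=
  f ⊙ dx g - (sgn b * (2 : ℂ)⁻¹) • (D1 f ⊙ D1 g + D2 f ⊙ D2 g)

/-- the Lie derivative `L^λ_{X_f} = X_f + λ f'` on `λ`-densities -/
def Lden (b : Bool) (f : SA) (lam : ℂ) (g : SA) : SA :=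
  XV b f g + lam • (dx f ⊙ g)

/-- the contact bracket `{f,g} = fg' - f'g - (-1)^{p(f)} ½ (D̄₁(f)D̄₁(g) + D̄₂(f)D̄₂(g))` -/
def cbr (b : Bool) (f g : SA) : SA :=
  f ⊙ dx g - dx f ⊙ g - (sgn b * (2 : ℂ)⁻¹) • (D1 f ⊙ D1 g + D2 f ⊙ D2 g)

/-- the Lie derivative `𝓛_{X_f}(T) = L^μ_{X_f}∘T - (-1)^{p(f)p(T)} T∘L^λ_{X_f}`
of a homogeneous operator `T` of parity `bT` from `λ`- to `μ`-densities -/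
def LieD (bf : Bool) (f : SA) (lam mu : ℂ) (bT : Bool) (T : SA → SA) : SA → SA :=
  fun g => Lden bf f mu (T g) - sgn2 bf bT • T (Lden bf f lam g)

def applyIf (b : Bool) (F : SA → SA) (g : SA) : SA := if b then F g else g

/-- the monomial operator `∂_x^ℓ D̄₁^m D̄₂^n` -/
def monoD (l : ℕ) (m n : Bool) (g : SA) : SA := dx^[l] (applyIf m D1 (applyIf n D2 g))

def bnat (b : Bool) : ℕ := if b then 1 else 0

/-- membership in `D^{K/2}_{λμ}`: differential operators
`Σ a_{ℓ,m,n} ∂_x^ℓ D̄₁^m D̄₂^n` of contact order `ℓ + m/2 + n/2 ≤ K/2`. -/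
def InD (K : ℕ) (T : SA → SA) : Prop :=
  ∃ a : ℕ → Bool → Bool → SA,
    (∀ l m n, Smooth (a l m n)) ∧
    (∀ l m n, ¬ (2 * l + bnat m + bnat n ≤ K) → a l m n = 0) ∧
    (∀ g, Smooth g →
      T g = ∑ l ∈ Finset.range (K + 1), ∑ m : Bool, ∑ n : Bool, a l m n ⊙ monoD l m n g)

end SA

open SA

namespace SA

lemma contDiff_deriv_top {u : ℝ → ℂ} (hu : ContDiff ℝ (⊤ : ℕ∞) u) :
    ContDiff ℝ (⊤ : ℕ∞) (deriv u) :=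
  (contDiff_infty_iff_deriv.mp hu).2

lemma contDiff_differentiable {u : ℝ → ℂ} (hu : ContDiff ℝ (⊤ : ℕ∞) u) (x : ℝ) :
    DifferentiableAt ℝ u x :=
  (contDiff_infty_iff_deriv.mp hu).1 x

/-! ### Smoothness -/

lemma Smooth.zero : Smooth (0 : SA) :=
  ⟨contDiff_const, contDiff_const, contDiff_const, contDiff_const⟩

lemma Smooth.one : Smooth SA.one :=
  ⟨contDiff_const, contDiff_const, contDiff_const, contDiff_const⟩

lemma Smooth.add {f g : SA} (hf : Smooth f) (hg : Smooth g) : Smooth (f + g) :=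
  ⟨hf.1.add hg.1, hf.2.1.add hg.2.1, hf.2.2.1.add hg.2.2.1, hf.2.2.2.add hg.2.2.2⟩

lemma Smooth.neg {f : SA} (hf : Smooth f) : Smooth (-f) :=
  ⟨hf.1.neg, hf.2.1.neg, hf.2.2.1.neg, hf.2.2.2.neg⟩

lemma Smooth.sub {f g : SA} (hf : Smooth f) (hg : Smooth g) : Smooth (f - g) :=
  ⟨hf.1.sub hg.1, hf.2.1.sub hg.2.1, hf.2.2.1.sub hg.2.2.1, hf.2.2.2.sub hg.2.2.2⟩

lemma Smooth.smul (c : ℂ) {f : SA} (hf : Smooth f) : Smooth (c • f) :=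
  ⟨contDiff_const.smul hf.1, contDiff_const.smul hf.2.1, contDiff_const.smul hf.2.2.1,
    contDiff_const.smul hf.2.2.2⟩

lemma Smooth.gmul {f g : SA} (hf : Smooth f) (hg : Smooth g) : Smooth (f ⊙ g) :=
  ⟨hf.1.mul hg.1, (hf.1.mul hg.2.1).add (hf.2.1.mul hg.1),
    (hf.1.mul hg.2.2.1).add (hf.2.2.1.mul hg.1),
    (((hf.1.mul hg.2.2.2).add (hf.2.2.2.mul hg.1)).add (hf.2.1.mul hg.2.2.1)).sub
      (hf.2.2.1.mul hg.2.1)⟩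

lemma Smooth.dx {f : SA} (hf : Smooth f) : Smooth (dx f) :=
  ⟨contDiff_deriv_top hf.1, contDiff_deriv_top hf.2.1, contDiff_deriv_top hf.2.2.1,
    contDiff_deriv_top hf.2.2.2⟩

lemma D1_eq (f : SA) : D1 f = (a1 f, -deriv (a0 f), a12 f, -deriv (a2 f)) := by
  simp [D1, dxi1, gmul, xi1, a0, a1, a2, a12, SA.dx]

lemma D2_eq (f : SA) : D2 f = (a2 f, -a12 f, -deriv (a0 f), deriv (a1 f)) := by
  simp [D2, dxi2, gmul, xi2, a0, a1, a2, a12, SA.dx]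

lemma Smooth.D1 {f : SA} (hf : Smooth f) : Smooth (D1 f) := by
  rw [D1_eq]
  exact ⟨hf.2.1, (contDiff_deriv_top hf.1).neg, hf.2.2.2, (contDiff_deriv_top hf.2.2.1).neg⟩

lemma Smooth.D2 {f : SA} (hf : Smooth f) : Smooth (D2 f) := by
  rw [D2_eq]
  exact ⟨hf.2.2.1, hf.2.2.2.neg, (contDiff_deriv_top hf.1).neg, contDiff_deriv_top hf.2.1⟩

lemma Smooth.XV (b : Bool) {f g : SA} (hf : Smooth f) (hg : Smooth g) : Smooth (XV b f g) :=
  (hf.gmul hg.dx).sub (((hf.D1.gmul hg.D1).add (hf.D2.gmul hg.D2)).smul _)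

lemma Smooth.iterate_dx {f : SA} (hf : Smooth f) (l : ℕ) : Smooth (SA.dx^[l] f) := by
  induction l with
  | zero => exact hf
  | succ l ih => rw [Function.iterate_succ_apply']; exact ih.dx

lemma Smooth.monoD {f : SA} (hf : Smooth f) (l : ℕ) (m n : Bool) : Smooth (monoD l m n f) := by
  refine Smooth.iterate_dx ?_ l
  cases m <;> cases n
  · exact hf
  · exact hf.D2
  · exact hf.D1
  · exact hf.D2.D1

/-! ### The Grassmann product -/

lemma gmul_assoc (f g h : SA) : f ⊙ g ⊙ h = f ⊙ (g ⊙ h) := by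
  simp only [gmul, a0, a1, a2, a12, Prod.mk.injEq]
  refine ⟨?_, ?_, ?_, ?_⟩ <;> ring

lemma gmul_add (f g h : SA) : f ⊙ (g + h) = f ⊙ g + f ⊙ h := by
  simp only [gmul, a0, a1, a2, a12, Prod.fst_add, Prod.snd_add, Prod.mk_add_mk, Prod.mk.injEq]
  refine ⟨?_, ?_, ?_, ?_⟩ <;> ring

lemma add_gmul (f g h : SA) : (f + g) ⊙ h = f ⊙ h + g ⊙ h := by
  simp only [gmul, a0, a1, a2, a12, Prod.fst_add, Prod.snd_add, Prod.mk_add_mk, Prod.mk.injEq]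
  refine ⟨?_, ?_, ?_, ?_⟩ <;> ring

lemma smul_gmul (c : ℂ) (f g : SA) : (c • f) ⊙ g = c • (f ⊙ g) := by
  refine Prod.ext ?_ (Prod.ext ?_ (Prod.ext ?_ ?_)) <;> funext x <;>
    simp [gmul, a0, a1, a2, a12]
  ring

lemma gmul_smul (c : ℂ) (f g : SA) : f ⊙ (c • g) = c • (f ⊙ g) := by
  refine Prod.ext ?_ (Prod.ext ?_ (Prod.ext ?_ ?_)) <;> funext x <;>
    simp [gmul, a0, a1, a2, a12]
  ring

lemma neg_gmul (f g : SA) : (-f) ⊙ g = -(f ⊙ g) := by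
  simpa using smul_gmul (-1) f g

lemma gmul_neg (f g : SA) : f ⊙ (-g) = -(f ⊙ g) := by
  simpa using gmul_smul (-1) f g

lemma sub_gmul (f g h : SA) : (f - g) ⊙ h = f ⊙ h - g ⊙ h := by
  rw [sub_eq_add_neg, add_gmul, neg_gmul, sub_eq_add_neg]

lemma gmul_sub (f g h : SA) : f ⊙ (g - h) = f ⊙ g - f ⊙ h := by
  rw [sub_eq_add_neg, gmul_add, gmul_neg, sub_eq_add_neg]

lemma gmul_zero (f : SA) : f ⊙ 0 = 0 := by
  simpa using gmul_smul 0 f 0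

lemma zero_gmul (f : SA) : 0 ⊙ f = 0 := by
  simpa using smul_gmul 0 0 f

lemma one_gmul (f : SA) : SA.one ⊙ f = f := by
  simp [gmul, SA.one, a0, a1, a2, a12]

/-- Supercommutativity of the Grassmann product. -/
lemma gmul_comm_of_homog {b c : Bool} {f g : SA} (hf : Homog b f) (hg : Homog c g) :
    f ⊙ g = sgn2 b c • (g ⊙ f) := by
  obtain ⟨f0, f1, f2, f12⟩ := f
  obtain ⟨g0, g1, g2, g12⟩ := g
  cases b <;> cases c <;>
    simp only [Homog, IsEven, IsOdd, a0, a1, a2, a12, if_true, if_false, Bool.false_eq_true]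
      at hf hg <;>
    obtain ⟨rfl, rfl⟩ := hf <;> obtain ⟨rfl, rfl⟩ := hg <;>
    simp [gmul, sgn2, a0, a1, a2, a12, mul_comm, add_comm, sub_eq_add_neg]

/-! ### The parity involution and the derivations -/

/-- The parity involution of `A`, acting by `(-1)^{p(f)}` on homogeneous `f`. -/
def parity (f : SA) : SA := (a0 f, -a1 f, -a2 f, a12 f)

lemma Smooth.parity {f : SA} (hf : Smooth f) : Smooth (parity f) :=
  ⟨hf.1, hf.2.1.neg, hf.2.2.1.neg, hf.2.2.2⟩

lemma Homog.parity_eq {b : Bool} {f : SA} (hf : Homog b f) : parity f = sgn b • f := by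
  obtain ⟨f0, f1, f2, f12⟩ := f
  cases b <;>
    simp only [Homog, IsEven, IsOdd, a0, a1, a2, a12, if_true, if_false, Bool.false_eq_true]
      at hf <;>
    obtain ⟨rfl, rfl⟩ := hf <;> simp [parity, sgn, a0, a1, a2, a12]

lemma Homog.dx {b : Bool} {f : SA} (hf : Homog b f) : Homog b (dx f) := by
  obtain ⟨f0, f1, f2, f12⟩ := f
  cases b <;>
    simp only [Homog, IsEven, IsOdd, a0, a1, a2, a12, if_true, if_false, Bool.false_eq_true]
      at hf ⊢ <;>
    obtain ⟨rfl, rfl⟩ := hf <;> simp [SA.dx, a0, a1, a2, a12]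

lemma Homog.D1 {b : Bool} {f : SA} (hf : Homog b f) : Homog (!b) (D1 f) := by
  rw [D1_eq]
  obtain ⟨f0, f1, f2, f12⟩ := f
  cases b <;>
    simp only [Homog, IsEven, IsOdd, a0, a1, a2, a12, if_true, if_false, Bool.false_eq_true,
      Bool.not_true, Bool.not_false] at hf ⊢ <;>
    obtain ⟨rfl, rfl⟩ := hf <;> simp

lemma Homog.D2 {b : Bool} {f : SA} (hf : Homog b f) : Homog (!b) (D2 f) := by
  rw [D2_eq]
  obtain ⟨f0, f1, f2, f12⟩ := f
  cases b <;>
    simp only [Homog, IsEven, IsOdd, a0, a1, a2, a12, if_true, if_false, Bool.false_eq_true,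
      Bool.not_true, Bool.not_false] at hf ⊢ <;>
    obtain ⟨rfl, rfl⟩ := hf <;> simp

lemma dx_neg (f : SA) : dx (-f) = -dx f := by
  refine Prod.ext ?_ (Prod.ext ?_ (Prod.ext ?_ ?_)) <;> exact funext fun x => deriv.neg

lemma dx_smul (c : ℂ) (f : SA) : dx (c • f) = c • dx f := by
  refine Prod.ext ?_ (Prod.ext ?_ (Prod.ext ?_ ?_)) <;> funext x <;>
    exact deriv_const_smul_field c _

lemma dx_add {f g : SA} (hf : Smooth f) (hg : Smooth g) : dx (f + g) = dx f + dx g := by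
  refine Prod.ext ?_ (Prod.ext ?_ (Prod.ext ?_ ?_)) <;> funext x
  · exact deriv_add (contDiff_differentiable hf.1 x) (contDiff_differentiable hg.1 x)
  · exact deriv_add (contDiff_differentiable hf.2.1 x) (contDiff_differentiable hg.2.1 x)
  · exact deriv_add (contDiff_differentiable hf.2.2.1 x) (contDiff_differentiable hg.2.2.1 x)
  · exact deriv_add (contDiff_differentiable hf.2.2.2 x) (contDiff_differentiable hg.2.2.2 x)

lemma D1_neg (f : SA) : D1 (-f) = -D1 f := by
  have h : dxi1 (-f) = -dxi1 f := by simp [dxi1, a1, a12]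
  rw [D1, D1, h, dx_neg, gmul_neg]; abel

lemma D2_neg (f : SA) : D2 (-f) = -D2 f := by
  have h : dxi2 (-f) = -dxi2 f := by simp [dxi2, a2, a12]
  rw [D2, D2, h, dx_neg, gmul_neg]; abel

lemma D1_smul (c : ℂ) (f : SA) : D1 (c • f) = c • D1 f := by
  have h : dxi1 (c • f) = c • dxi1 f := by simp [dxi1, a1, a12]
  rw [D1, D1, h, dx_smul, gmul_smul, smul_sub]

lemma D2_smul (c : ℂ) (f : SA) : D2 (c • f) = c • D2 f := by
  have h : dxi2 (c • f) = c • dxi2 f := by simp [dxi2, a2, a12]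
  rw [D2, D2, h, dx_smul, gmul_smul, smul_sub]

lemma D1_add {f g : SA} (hf : Smooth f) (hg : Smooth g) : D1 (f + g) = D1 f + D1 g := by
  have h : dxi1 (f + g) = dxi1 f + dxi1 g := by simp [dxi1, a1, a12]
  rw [D1, D1, D1, h, dx_add hf hg, gmul_add]; abel

lemma D2_add {f g : SA} (hf : Smooth f) (hg : Smooth g) : D2 (f + g) = D2 f + D2 g := by
  have h : dxi2 (f + g) = dxi2 f + dxi2 g := by simp [dxi2, a2, a12]; abel
  rw [D2, D2, D2, h, dx_add hf hg, gmul_add]; abel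

lemma dx_sub {f g : SA} (hf : Smooth f) (hg : Smooth g) : dx (f - g) = dx f - dx g := by
  rw [sub_eq_add_neg, dx_add hf hg.neg, dx_neg, sub_eq_add_neg]

lemma D1_sub {f g : SA} (hf : Smooth f) (hg : Smooth g) : D1 (f - g) = D1 f - D1 g := by
  rw [sub_eq_add_neg, D1_add hf hg.neg, D1_neg, sub_eq_add_neg]

lemma D2_sub {f g : SA} (hf : Smooth f) (hg : Smooth g) : D2 (f - g) = D2 f - D2 g := by
  rw [sub_eq_add_neg, D2_add hf hg.neg, D2_neg, sub_eq_add_neg]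

lemma D1_dx (f : SA) : D1 (dx f) = dx (D1 f) := by
  simp only [D1_eq, dx, a0, a1, a2, a12, Prod.mk.injEq, true_and]
  exact ⟨funext fun x => deriv.neg.symm, funext fun x => deriv.neg.symm⟩

lemma D2_dx (f : SA) : D2 (dx f) = dx (D2 f) := by
  simp only [D2_eq, dx, a0, a1, a2, a12, Prod.mk.injEq, true_and, and_true]
  exact ⟨funext fun x => deriv.neg.symm, funext fun x => deriv.neg.symm⟩

lemma D1_D1 (f : SA) : D1 (D1 f) = -dx f := by
  simp [D1_eq, dx, a0, a1, a2, a12]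

lemma D2_D2 (f : SA) : D2 (D2 f) = -dx f := by
  simp only [D2_eq, dx, a0, a1, a2, a12, Prod.neg_mk, Prod.mk.injEq, true_and]
  exact funext fun x => deriv.neg

lemma D2_D1 (f : SA) : D2 (D1 f) = -D1 (D2 f) := by
  simp only [D1_eq, D2_eq, a0, a1, a2, a12, Prod.neg_mk, neg_neg]

lemma dx_gmul {f g : SA} (hf : Smooth f) (hg : Smooth g) :
    dx (f ⊙ g) = dx f ⊙ g + f ⊙ dx g := by
  obtain ⟨f0, f1, f2, f12⟩ := hf
  obtain ⟨g0, g1, g2, g12⟩ := hg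
  have mul : ∀ {u v : ℝ → ℂ}, ContDiff ℝ (⊤ : ℕ∞) u → ContDiff ℝ (⊤ : ℕ∞) v →
      ContDiff ℝ (⊤ : ℕ∞) (u * v) := fun hu hv => hu.mul hv
  have key : ∀ {u v : ℝ → ℂ}, ContDiff ℝ (⊤ : ℕ∞) u → ContDiff ℝ (⊤ : ℕ∞) v →
      deriv (u * v) = deriv u * v + u * deriv v := fun hu hv => funext fun x =>
    deriv_mul (contDiff_differentiable hu x) (contDiff_differentiable hv x)
  have addc : ∀ {u v : ℝ → ℂ}, ContDiff ℝ (⊤ : ℕ∞) u → ContDiff ℝ (⊤ : ℕ∞) v →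
      ContDiff ℝ (⊤ : ℕ∞) (u + v) := fun hu hv => hu.add hv
  have add : ∀ {u v : ℝ → ℂ}, ContDiff ℝ (⊤ : ℕ∞) u → ContDiff ℝ (⊤ : ℕ∞) v →
      deriv (u + v) = deriv u + deriv v := fun hu hv => funext fun x =>
    deriv_add (contDiff_differentiable hu x) (contDiff_differentiable hv x)
  have sub : ∀ {u v : ℝ → ℂ}, ContDiff ℝ (⊤ : ℕ∞) u → ContDiff ℝ (⊤ : ℕ∞) v →
      deriv (u - v) = deriv u - deriv v := fun hu hv => funext fun x =>
    deriv_sub (contDiff_differentiable hu x) (contDiff_differentiable hv x)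
  refine Prod.ext ?_ (Prod.ext ?_ (Prod.ext ?_ ?_))
  · change deriv (a0 f * a0 g) = deriv (a0 f) * a0 g + a0 f * deriv (a0 g)
    exact key f0 g0
  · change deriv (a0 f * a1 g + a1 f * a0 g) = (deriv (a0 f) * a1 g + deriv (a1 f) * a0 g) +
      (a0 f * deriv (a1 g) + a1 f * deriv (a0 g))
    rw [add (mul f0 g1) (mul f1 g0), key f0 g1, key f1 g0]; ring
  · change deriv (a0 f * a2 g + a2 f * a0 g) = (deriv (a0 f) * a2 g + deriv (a2 f) * a0 g) +
      (a0 f * deriv (a2 g) + a2 f * deriv (a0 g))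
    rw [add (mul f0 g2) (mul f2 g0), key f0 g2, key f2 g0]; ring
  · change deriv (a0 f * a12 g + a12 f * a0 g + a1 f * a2 g - a2 f * a1 g) =
      (deriv (a0 f) * a12 g + deriv (a12 f) * a0 g + deriv (a1 f) * a2 g - deriv (a2 f) * a1 g) +
      (a0 f * deriv (a12 g) + a12 f * deriv (a0 g) + a1 f * deriv (a2 g) - a2 f * deriv (a1 g))
    rw [sub (addc (addc (mul f0 g12) (mul f12 g0)) (mul f1 g2)) (mul f2 g1),
      add (addc (mul f0 g12) (mul f12 g0)) (mul f1 g2), add (mul f0 g12) (mul f12 g0),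
      key f0 g12, key f12 g0, key f1 g2, key f2 g1]
    ring

lemma D1_gmul {f g : SA} (hf : Smooth f) (hg : Smooth g) :
    D1 (f ⊙ g) = D1 f ⊙ g + parity f ⊙ D1 g := by
  rw [D1, dx_gmul hf hg, D1, D1]
  simp only [gmul, dx, dxi1, xi1, parity, a0, a1, a2, a12,
    Prod.mk_add_mk, Prod.mk_sub_mk, Prod.mk.injEq]
  refine ⟨?_, ?_, ?_, ?_⟩ <;> ring

lemma D2_gmul {f g : SA} (hf : Smooth f) (hg : Smooth g) :
    D2 (f ⊙ g) = D2 f ⊙ g + parity f ⊙ D2 g := by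
  rw [D2, dx_gmul hf hg, D2, D2]
  simp only [gmul, dx, dxi2, xi2, parity, a0, a1, a2, a12,
    Prod.mk_add_mk, Prod.mk_sub_mk, Prod.mk.injEq]
  refine ⟨?_, ?_, ?_, ?_⟩ <;> ring

/-! ### Commutation rules for the contact vector field -/

/-- The contact vector field is a superderivation. -/
lemma XV_gmul {b c : Bool} {f F u : SA} (hf : Homog b f) (hF : Homog c F)
    (sF : Smooth F) (su : Smooth u) :
    XV b f (F ⊙ u) = XV b f F ⊙ u + sgn2 b c • (F ⊙ XV b f u) := by
  have h0 : F ⊙ (f ⊙ dx u) = sgn2 c b • (f ⊙ (F ⊙ dx u)) := by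
    rw [← gmul_assoc, gmul_comm_of_homog hF hf, smul_gmul, gmul_assoc]
  have h1 : F ⊙ (D1 f ⊙ D1 u) = sgn2 c (!b) • (D1 f ⊙ (F ⊙ D1 u)) := by
    rw [← gmul_assoc, gmul_comm_of_homog hF hf.D1, smul_gmul, gmul_assoc]
  have h2 : F ⊙ (D2 f ⊙ D2 u) = sgn2 c (!b) • (D2 f ⊙ (F ⊙ D2 u)) := by
    rw [← gmul_assoc, gmul_comm_of_homog hF hf.D2, smul_gmul, gmul_assoc]
  simp only [XV, dx_gmul sF su, D1_gmul sF su, D2_gmul sF su, hF.parity_eq, gmul_add, add_gmul,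
    gmul_sub, sub_gmul, gmul_smul, smul_gmul, gmul_assoc, h0, h1, h2]
  cases b <;> cases c <;> simp [sgn, sgn2] <;> module

lemma XV_dx (b : Bool) {f u : SA} (sf : Smooth f) (su : Smooth u) :
    XV b f (dx u) = dx (XV b f u) - dx f ⊙ dx u +
      (sgn b * (2 : ℂ)⁻¹) • (D1 (dx f) ⊙ D1 u + D2 (dx f) ⊙ D2 u) := by
  rw [XV, XV, dx_sub (sf.gmul su.dx) (((sf.D1.gmul su.D1).add (sf.D2.gmul su.D2)).smul _),
    dx_smul, dx_add (sf.D1.gmul su.D1) (sf.D2.gmul su.D2), dx_gmul sf su.dx,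
    dx_gmul sf.D1 su.D1, dx_gmul sf.D2 su.D2]
  simp only [D1_dx, D2_dx]
  module

lemma XV_D1_D2 {b : Bool} {f u : SA} (hf : Homog b f) (sf : Smooth f) (su : Smooth u) :
    XV b f (D1 (D2 u)) = D1 (D2 (XV b f u)) - dx f ⊙ D1 (D2 u) +
      (sgn b * (2 : ℂ)⁻¹) • (D2 (dx f) ⊙ D1 u - D1 (dx f) ⊙ D2 u) := by
  have e2 : D2 (XV b f u) = (sgn b) • XV b f (D2 u) + (sgn b * (2 : ℂ)⁻¹) • (dx f ⊙ D2 u)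
      + (sgn b * (2 : ℂ)⁻¹) • (D1 (D2 f) ⊙ D1 u) := by
    rw [XV, XV, D2_sub (sf.gmul su.dx) (((sf.D1.gmul su.D1).add (sf.D2.gmul su.D2)).smul _),
      D2_smul, D2_add (sf.D1.gmul su.D1) (sf.D2.gmul su.D2), D2_gmul sf su.dx,
      D2_gmul sf.D1 su.D1, D2_gmul sf.D2 su.D2, hf.parity_eq, hf.D1.parity_eq, hf.D2.parity_eq]
    simp only [D2_dx, D2_D2, D2_D1, smul_gmul, gmul_neg, neg_gmul]
    cases b <;> simp [sgn] <;> module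
  have e1 : ∀ v, Smooth v → D1 (XV b f v) = (sgn b) • XV b f (D1 v) +
      (sgn b * (2 : ℂ)⁻¹) • (dx f ⊙ D1 v) - (sgn b * (2 : ℂ)⁻¹) • (D1 (D2 f) ⊙ D2 v) := by
    intro v sv
    rw [XV, XV, D1_sub (sf.gmul sv.dx) (((sf.D1.gmul sv.D1).add (sf.D2.gmul sv.D2)).smul _),
      D1_smul, D1_add (sf.D1.gmul sv.D1) (sf.D2.gmul sv.D2), D1_gmul sf sv.dx,
      D1_gmul sf.D1 sv.D1, D1_gmul sf.D2 sv.D2, hf.parity_eq, hf.D1.parity_eq, hf.D2.parity_eq]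
    simp only [D1_dx, D1_D1, D2_D1, smul_gmul, gmul_neg, neg_gmul]
    cases b <;> simp [sgn] <;> module
  rw [e2, D1_add (((sf.XV b su.D2).smul _).add ((sf.dx.gmul su.D2).smul _))
      ((sf.D2.D1.gmul su.D1).smul _),
    D1_add ((sf.XV b su.D2).smul _) ((sf.dx.gmul su.D2).smul _), D1_smul, D1_smul, D1_smul,
    e1 _ su.D2, D1_gmul sf.dx su.D2, D1_gmul sf.D2.D1 su.D1, hf.dx.parity_eq,
    hf.D2.D1.parity_eq]
  simp only [D1_dx, D2_dx, D1_D1, D2_D2, smul_gmul, gmul_neg, neg_gmul]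
  cases b <;> simp [sgn] <;> module

/-! ### Differential operators of bounded contact order -/

/-- Operators of contact order strictly less than `K/2`. -/
inductive Lower (K : ℕ) : (SA → SA) → Prop
  | zero : Lower K (fun _ => 0)
  | monoD (a : SA) (l : ℕ) (m n : Bool) : Smooth a → 2 * l + bnat m + bnat n < K →
      Lower K (fun g => a ⊙ monoD l m n g)
  | add {S T : SA → SA} : Lower K S → Lower K T → Lower K (fun g => S g + T g)
  | congr {S T : SA → SA} : Lower K S → (∀ g, Smooth g → S g = T g) → Lower K T

namespace Lower

variable {K : ℕ} {S T : SA → SA}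

lemma smooth (h : Lower K T) {g : SA} (hg : Smooth g) : Smooth (T g) := by
  induction h with
  | zero => exact Smooth.zero
  | monoD a l m n ha _ => exact ha.gmul (hg.monoD l m n)
  | add _ _ hS hT => exact hS.add hT
  | congr _ e ih => rw [← e g hg]; exact ih

lemma mono {K' : ℕ} (h : Lower K T) (hK : K ≤ K') : Lower K' T := by
  induction h with
  | zero => exact zero
  | monoD a l m n ha hl => exact monoD a l m n ha (by omega)
  | add _ _ hS hT => exact hS.add hT
  | congr _ e ih => exact ih.congr e

lemma gmul (h : Lower K T) {c : SA} (hc : Smooth c) : Lower K (fun g => c ⊙ T g) := by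
  induction h with
  | zero => exact zero.congr fun _ _ => (gmul_zero c).symm
  | monoD a l m n ha hl =>
    exact (monoD (c ⊙ a) l m n (hc.gmul ha) hl).congr fun _ _ => gmul_assoc _ _ _
  | add _ _ hS hT => exact (hS.add hT).congr fun g _ => (gmul_add _ _ _).symm
  | congr _ e ih => exact ih.congr fun g hg => by rw [e g hg]

lemma smul (h : Lower K T) (c : ℂ) : Lower K (fun g => c • T g) :=
  (h.gmul (Smooth.one.smul c)).congr fun g _ => by rw [smul_gmul, one_gmul]

lemma sub (hS : Lower K S) (hT : Lower K T) : Lower K (fun g => S g - T g) :=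
  (hS.add (hT.smul (-1))).congr fun _ _ => by module

lemma of_monoD (l : ℕ) (m n : Bool) (h : 2 * l + bnat m + bnat n < K) :
    Lower K (SA.monoD l m n) :=
  (monoD SA.one l m n Smooth.one h).congr fun _ _ => one_gmul _

lemma dx (h : Lower K T) : Lower (K + 2) (fun g => dx (T g)) := by
  induction h with
  | zero => exact zero.congr fun g _ => by simpa using (dx_smul 0 0).symm
  | monoD a l m n ha hl =>
    refine ((monoD (SA.dx a) l m n ha.dx (by omega)).add
      (monoD a (l + 1) m n ha (by omega))).congr fun g hg => ?_
    rw [dx_gmul ha (hg.monoD l m n), SA.monoD, SA.monoD, Function.iterate_succ_apply']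
  | add hS hT ihS ihT =>
    exact (ihS.add ihT).congr fun g hg => (dx_add (hS.smooth hg) (hT.smooth hg)).symm
  | congr _ e ih => exact ih.congr fun g hg => by rw [e g hg]

end Lower

lemma iterate_dx_neg (l : ℕ) (f : SA) : dx^[l] (-f) = -dx^[l] f :=
  Function.Commute.iterate_left (g := Neg.neg) dx_neg l f

lemma D1_iterate_dx (l : ℕ) (f : SA) : D1 (dx^[l] f) = dx^[l] (D1 f) :=
  Function.Commute.iterate_right D1_dx l f

lemma D2_iterate_dx (l : ℕ) (f : SA) : D2 (dx^[l] f) = dx^[l] (D2 f) :=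
  Function.Commute.iterate_right D2_dx l f

namespace Lower

variable {K : ℕ} {T : SA → SA}

lemma D1_monoD (l : ℕ) (m n : Bool) (h : 2 * l + bnat m + bnat n < K) :
    Lower (K + 1) (fun g => D1 (SA.monoD l m n g)) := by
  cases m
  · refine (of_monoD l true n (by simp [bnat] at h ⊢; omega)).congr fun g _ => ?_
    simp [SA.monoD, applyIf, D1_iterate_dx]
  · refine ((of_monoD (l + 1) false n (by simp [bnat] at h ⊢; omega)).smul (-1)).congr
      fun g _ => ?_
    simp [SA.monoD, applyIf, D1_iterate_dx, D1_D1, iterate_dx_neg]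

lemma D2_monoD (l : ℕ) (m n : Bool) (h : 2 * l + bnat m + bnat n < K) :
    Lower (K + 1) (fun g => D2 (SA.monoD l m n g)) := by
  cases m <;> cases n
  · refine (of_monoD l false true (by simp [bnat] at h ⊢; omega)).congr fun g _ => ?_
    simp [SA.monoD, applyIf, D2_iterate_dx]
  · refine ((of_monoD (l + 1) false false (by simp [bnat] at h ⊢; omega)).smul (-1)).congr
      fun g _ => ?_
    simp [SA.monoD, applyIf, D2_iterate_dx, D2_D2, iterate_dx_neg]
  · refine ((of_monoD l true true (by simp [bnat] at h ⊢; omega)).smul (-1)).congr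
      fun g _ => ?_
    simp [SA.monoD, applyIf, D2_iterate_dx, D2_D1, iterate_dx_neg]
  · refine (of_monoD (l + 1) true false (by simp [bnat] at h ⊢; omega)).congr fun g _ => ?_
    simp [SA.monoD, applyIf, D2_iterate_dx, D2_D1, D2_D2, D1_neg, D1_dx]

lemma D1 (h : Lower K T) : Lower (K + 1) (fun g => D1 (T g)) := by
  induction h with
  | zero => exact zero.congr fun g _ => by simpa using (D1_smul 0 0).symm
  | monoD a l m n ha hl =>
    exact ((monoD (SA.D1 a) l m n ha.D1 (by omega)).add ((D1_monoD l m n hl).gmul ha.parity)).congr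
      fun g hg => (D1_gmul ha (hg.monoD l m n)).symm
  | add hS hT ihS ihT =>
    exact (ihS.add ihT).congr fun g hg => (D1_add (hS.smooth hg) (hT.smooth hg)).symm
  | congr _ e ih => exact ih.congr fun g hg => by rw [e g hg]

lemma D2 (h : Lower K T) : Lower (K + 1) (fun g => D2 (T g)) := by
  induction h with
  | zero => exact zero.congr fun g _ => by simpa using (D2_smul 0 0).symm
  | monoD a l m n ha hl =>
    exact ((monoD (SA.D2 a) l m n ha.D2 (by omega)).add ((D2_monoD l m n hl).gmul ha.parity)).congr
      fun g hg => (D2_gmul ha (hg.monoD l m n)).symm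
  | add hS hT ihS ihT =>
    exact (ihS.add ihT).congr fun g hg => (D2_add (hS.smooth hg) (hT.smooth hg)).symm
  | congr _ e ih => exact ih.congr fun g hg => by rw [e g hg]

lemma inD (h : Lower (K + 1) T) : InD K T := by
  induction h with
  | zero => exact ⟨fun _ _ _ => 0, fun _ _ _ => Smooth.zero, fun _ _ _ _ => rfl,
      fun g _ => by simp [zero_gmul]⟩
  | monoD a l m n ha hl =>
    refine ⟨fun l' m' n' => if l' = l ∧ m' = m ∧ n' = n then a else 0, fun l' m' n' => ?_,
      fun l' m' n' h => ?_, fun g _ => ?_⟩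
    · dsimp only
      split_ifs
      exacts [ha, Smooth.zero]
    · dsimp only
      rw [if_neg]
      rintro ⟨rfl, rfl, rfl⟩
      omega
    · rw [Finset.sum_eq_single_of_mem l (by simp; omega), Finset.sum_eq_single_of_mem m (by simp),
        Finset.sum_eq_single_of_mem n (by simp)]
      · simp
      all_goals
        intro j _ hj
        simp [hj, zero_gmul]
  | add _ _ hS hT =>
    obtain ⟨a, ha, ha', ea⟩ := hS
    obtain ⟨c, hc, hc', ec⟩ := hT
    refine ⟨fun l m n => a l m n + c l m n, fun l m n => (ha l m n).add (hc l m n),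
      fun l m n h => by simp [ha' l m n h, hc' l m n h], fun g hg => ?_⟩
    simp only [ea g hg, ec g hg, add_gmul, Finset.sum_add_distrib]
  | congr _ e ih =>
    obtain ⟨a, ha, ha', ea⟩ := ih
    exact ⟨a, ha, ha', fun g hg => by rw [← e g hg, ea g hg]⟩

end Lower

/-! ### Monomials transforming as densities up to lower order -/

/-- `P` has contact order at most `k` and, modulo operators of order less than `k`, it commutes
with multiplications and satisfies `[X_f, P] = -k f' P`. -/
structure SymbolRule (b : Bool) (f : SA) (k : ℕ) (P : SA → SA) : Prop where
  map_add : ∀ u v, Smooth u → Smooth v → P (u + v) = P u + P v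
  map_smul : ∀ (c : ℂ) u, P (c • u) = c • P u
  order : Lower (2 * k + 1) P
  comm : Lower (2 * k) (fun g => XV b f (P g) - P (XV b f g) + (k : ℂ) • (dx f ⊙ P g))
  mul : ∀ h, Smooth h → Lower (2 * k) (fun g => P (h ⊙ g) - h ⊙ P g)

namespace SymbolRule

variable {b : Bool} {f : SA} {k : ℕ} {P : SA → SA}

lemma id : SymbolRule b f 0 (fun g => g) where
  map_add _ _ _ _ := rfl
  map_smul _ _ := rfl
  order := Lower.of_monoD 0 false false (by simp [bnat])
  comm := Lower.zero.congr fun g _ => by simp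
  mul _ _ := Lower.zero.congr fun g _ => by simp

lemma D1_D2 (hf : Homog b f) (sf : Smooth f) : SymbolRule b f 1 (fun g => D1 (D2 g)) where
  map_add u v su sv := by rw [D2_add su sv, D1_add su.D2 sv.D2]
  map_smul c u := by rw [D2_smul, D1_smul]
  order := Lower.of_monoD 0 true true (by simp [bnat])
  comm := by
    refine (((Lower.of_monoD 0 true false (by simp [bnat])).gmul sf.dx.D2).sub
      ((Lower.of_monoD 0 false true (by simp [bnat])).gmul sf.dx.D1)).smul
        (sgn b * (2 : ℂ)⁻¹) |>.congr fun g hg => ?_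
    rw [XV_D1_D2 hf sf hg]
    simp only [monoD, applyIf, Function.iterate_zero_apply, if_true, Bool.false_eq_true, if_false]
    push_cast
    module
  mul h sh := by
    refine (((Lower.of_monoD 0 false false (by simp [bnat])).gmul sh.D2.D1).add
      ((Lower.of_monoD 0 true false (by simp [bnat])).gmul sh.D2.parity)).add
      ((Lower.of_monoD 0 false true (by simp [bnat])).gmul sh.parity.D1) |>.congr fun g hg => ?_
    have hp : parity (parity h) = h := by simp [parity, a0, a1, a2, a12]
    rw [D2_gmul sh hg, D1_add (sh.D2.gmul hg) (sh.parity.gmul hg.D2), D1_gmul sh.D2 hg,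
      D1_gmul sh.parity hg.D2, hp]
    simp only [monoD, applyIf, Function.iterate_zero_apply, if_true, Bool.false_eq_true, if_false]
    abel

lemma dx (sf : Smooth f) (h : SymbolRule b f k P) :
    SymbolRule b f (k + 1) (fun g => dx (P g)) where
  map_add u v su sv := by
    rw [h.map_add u v su sv, dx_add (h.order.smooth su) (h.order.smooth sv)]
  map_smul c u := by rw [h.map_smul, dx_smul]
  order := h.order.dx
  comm := by
    refine ((((h.order.D1.gmul sf.dx.D1).add (h.order.D2.gmul sf.dx.D2)).smul
      (sgn b * (2 : ℂ)⁻¹)).add h.comm.dx).sub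
      (((h.order.gmul sf.dx.dx).smul k).mono (by omega)) |>.congr fun g hg => ?_
    have sP := h.order.smooth hg
    have sPX := h.order.smooth (sf.XV b hg)
    rw [XV_dx b sf sP, dx_add ((sf.XV b sP).sub sPX) ((sf.dx.gmul sP).smul _),
      dx_sub (sf.XV b sP) sPX, dx_smul, dx_gmul sf.dx sP]
    push_cast
    module
  mul c sc := by
    refine (h.mul c sc).dx.add ((h.order.gmul sc.dx).mono (by omega)) |>.congr fun g hg => ?_
    have sP := h.order.smooth hg
    rw [dx_sub (h.order.smooth (sc.gmul hg)) (sc.gmul sP), dx_gmul sc sP]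
    abel

lemma iterate_dx (sf : Smooth f) (h : SymbolRule b f k P) (j : ℕ) :
    SymbolRule b f (k + j) (fun g => SA.dx^[j] (P g)) := by
  induction j with
  | zero => exact h
  | succ j ih => simpa only [Function.iterate_succ_apply', Nat.add_assoc] using ih.dx sf

/-- Left multiplication by `F` turns a monomial of order `k` into a symbol transforming as a
`(μ - λ - k)`-density. -/
lemma lower_LieD {c : Bool} {F : SA} (h : SymbolRule b f k P) (hf : Homog b f) (sf : Smooth f)
    (hF : Homog c F) (sF : Smooth F) (lam mu : ℂ) :
    Lower (2 * k) (fun g => LieD b f lam mu c (fun u => F ⊙ P u) g -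
      Lden b f (mu - lam - k) F ⊙ P g) := by
  refine ((h.comm.gmul sF).sub (((h.mul _ sf.dx).gmul sF).smul lam)).smul (sgn2 b c) |>.congr
    fun g hg => ?_
  have sP := h.order.smooth hg
  have hcomm : ∀ v, F ⊙ (SA.dx f ⊙ v) = sgn2 c b • (SA.dx f ⊙ (F ⊙ v)) := fun v => by
    rw [← gmul_assoc, gmul_comm_of_homog hF hf.dx, smul_gmul, gmul_assoc]
  simp only [LieD, Lden]
  rw [XV_gmul hf hF sF sP, h.map_add _ _ (sf.XV b hg) ((sf.dx.gmul hg).smul _), h.map_smul]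
  simp only [gmul_add, gmul_sub, add_gmul, gmul_smul, smul_gmul, gmul_assoc, hcomm]
  cases b <;> cases c <;> simp [sgn2] <;> module

end SymbolRule

lemma LieD_add (b c : Bool) (f : SA) (lam mu : ℂ) (S T : SA → SA) {g : SA}
    (hS : Smooth (S g)) (hT : Smooth (T g)) :
    LieD b f lam mu c (fun u => S u + T u) g =
      LieD b f lam mu c S g + LieD b f lam mu c T g := by
  simp only [LieD, Lden, XV, dx_add hS hT, D1_add hS hT, D2_add hS hT, gmul_add]
  module

end SA

/-- Action on principal symbols of integer contact order
`k ≥ 1`: for a homogeneous `f` and a homogeneous symbol `(F₁,F₂)`,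
`𝓛_{X_f}(F₁∂_x^k + F₂∂_x^{k-1}D̄₁D̄₂)` equals
`(L^{μ-λ-k}_{X_f}F₁)∂_x^k + (L^{μ-λ-k}_{X_f}F₂)∂_x^{k-1}D̄₁D̄₂` modulo
`D^{k-1/2}_{λμ}`: both components of the principal symbol transform as
`(μ-λ-k)`-densities. -/
theorem statement7 :
    ∀ (k : ℕ), 1 ≤ k →
    ∀ (lam mu : ℂ) (bf bF : Bool) (f F1 F2 : SA),
      Smooth f → Smooth F1 → Smooth F2 →
      Homog bf f → Homog bF F1 → Homog bF F2 →
      InD (2 * k - 1) (fun g =>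
        LieD bf f lam mu bF
          (fun u => F1 ⊙ dx^[k] u + F2 ⊙ dx^[k-1] (D1 (D2 u))) g
        - (Lden bf f (mu - lam - (k : ℂ)) F1 ⊙ dx^[k] g
           + Lden bf f (mu - lam - (k : ℂ)) F2 ⊙ dx^[k-1] (D1 (D2 g)))) := by
  intro k hk lam mu bf bF f F1 F2 sf sF1 sF2 hf hF1 hF2
  obtain ⟨j, rfl⟩ : ∃ j, k = 1 + j := ⟨k - 1, by omega⟩
  have r1 : SymbolRule bf f (1 + j) (fun g => dx^[1 + j] g) := by
    simpa only [Nat.zero_add] using (SymbolRule.id (b := bf) (f := f)).iterate_dx sf (1 + j)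
  have r2 := (SymbolRule.D1_D2 hf sf).iterate_dx sf j
  rw [Nat.add_sub_cancel_left]
  refine Lower.inD (((r1.lower_LieD hf sf hF1 sF1 lam mu).add
    (r2.lower_LieD hf sf hF2 sF2 lam mu)).mono (by omega) |>.congr fun g hg => ?_)
  rw [LieD_add bf bF f lam mu (fun u => F1 ⊙ dx^[1 + j] u) (fun u => F2 ⊙ dx^[j] (D1 (D2 u)))
    (sF1.gmul (r1.order.smooth hg)) (sF2.gmul (r2.order.smooth hg))]
  abel
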